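/- Let a, b > 0 satisfy the nine inequalities 2a + b ≥ 1, 3a + 4b ≥ 2, 9a + 11b ≥ 6, a + 5b ≥ 1, 4a + 9b ≥ 3, 10a + 16b ≥ 7, 13a + 20b ≥ 8, 5a + 14b ≥ 4, a + (3/2)b ≥ 2/3. Let G be a graph with no triangle adjacent to a 4-cycle such that α(G) < |V(G)| − (a|V(G)| + b|E(G)| + bλ(G)), and suppose every graph G' with fewer vertices than G and no triangle adjacent to a 4-cycle satisfies α(G') ≥ |V(G')| − (a|V(G')| + b|E(G')| + bλ(G')). Then λ(G) = 0, i.e., G has no difficult components. -/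

import Mathlib

namespace Paper

/-- `s` is an independent set in the simple graph `G`. -/
def IsIndepSet {V : Type} (G : SimpleGraph V) (s : Finset V) : Prop :=
  ∀ v ∈ s, ∀ w ∈ s, ¬ G.Adj v w

/-- The independence number `α(G)`: the size of a largest independent set. -/
noncomputable def indepNum {V : Type} (G : SimpleGraph V) : ℕ :=
  sSup {n | ∃ s : Finset V, IsIndepSet G s ∧ s.card = n}

/-- The number of edges `|E(G)|`. -/
noncomputable def numEdges {V : Type} (G : SimpleGraph V) : ℕ :=
  Nat.card G.edgeSet

/-- The degree of a vertex. -/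
noncomputable def deg {V : Type} (G : SimpleGraph V) (v : V) : ℕ :=
  Nat.card (G.neighborSet v)

/-- `G` contains a triangle sharing a common edge with a 4-cycle:
the triangle `u v w` and the 4-cycle `u v x y` share the edge `u v`. -/
def HasTriangleAdjC4 {V : Type} (G : SimpleGraph V) : Prop :=
  ∃ u v w x y : V, G.Adj u v ∧ G.Adj v w ∧ G.Adj w u ∧
    G.Adj v x ∧ G.Adj x y ∧ G.Adj y u ∧ u ≠ x ∧ v ≠ y

/-- `G` contains two triangles sharing a common edge:
the triangles `u v w` and `u v x` share the edge `u v`. -/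
def HasAdjTriangles {V : Type} (G : SimpleGraph V) : Prop :=
  ∃ u v w x : V, G.Adj u v ∧ G.Adj v w ∧ G.Adj w u ∧
    G.Adj v x ∧ G.Adj x u ∧ w ≠ x

/-- `G` contains a triangle sharing a common edge with a 5-cycle:
the triangle `u v w` and the 5-cycle `u v x y z` share the edge `u v`. -/
def HasTriangleAdjC5 {V : Type} (G : SimpleGraph V) : Prop :=
  ∃ u v w x y z : V, G.Adj u v ∧ G.Adj v w ∧ G.Adj w u ∧
    G.Adj v x ∧ G.Adj x y ∧ G.Adj y z ∧ G.Adj z u ∧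
    u ≠ x ∧ u ≠ y ∧ v ≠ y ∧ v ≠ z ∧ x ≠ z

/-- The 2-chain of triangles: two disjoint triangles `{0,1,2}` and `{3,4,5}`
joined by the single edge `{2,3}` (6 vertices, 7 edges). -/
def chainGraph : SimpleGraph (Fin 6) :=
  SimpleGraph.fromRel (fun i j =>
    (i.val, j.val) ∈ [(0,1), (0,2), (1,2), (3,4), (3,5), (4,5), (2,3)])

/-- A connected component is difficult if it is a triangle or a 2-chain of triangles. -/
def IsDifficult {V : Type} (G : SimpleGraph V) (c : G.ConnectedComponent) : Prop :=
  Nonempty (SimpleGraph.induce c.supp G ≃g (⊤ : SimpleGraph (Fin 3))) ∨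
  Nonempty (SimpleGraph.induce c.supp G ≃g chainGraph)

/-- `λ(G)`: the number of difficult components of `G`. -/
noncomputable def lambda {V : Type} (G : SimpleGraph V) : ℕ :=
  Nat.card {c : G.ConnectedComponent // IsDifficult G c}

/-- `Φ(S)`: the number of edges of `G` with exactly one endpoint in `S`. -/
noncomputable def phi {V : Type} (G : SimpleGraph V) (S : Set V) : ℕ :=
  Nat.card {e : Sym2 V | e ∈ G.edgeSet ∧ ∃ x ∈ S, ∃ y, y ∉ S ∧ e = s(x, y)}

theorem HasTriangleAdjC4.of_induce {V : Type} {G : SimpleGraph V} {s : Set V}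
    (h : HasTriangleAdjC4 (G.induce s)) : HasTriangleAdjC4 G := by
  obtain ⟨u, v, w, x, y, huv, hvw, hwu, hvx, hxy, hyu, hux, hvy⟩ := h
  exact ⟨u, v, w, x, y, huv, hvw, hwu, hvx, hxy, hyu,
    Subtype.coe_injective.ne hux, Subtype.coe_injective.ne hvy⟩

theorem bddAbove_card_isIndepSet {V : Type} [Fintype V] (G : SimpleGraph V) :
    BddAbove {n | ∃ s : Finset V, IsIndepSet G s ∧ s.card = n} := by
  refine ⟨Fintype.card V, ?_⟩
  rintro n ⟨s, -, rfl⟩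
  exact s.card_le_univ

theorem IsIndepSet.card_le_indepNum {V : Type} [Fintype V] {G : SimpleGraph V} {s : Finset V}
    (hs : IsIndepSet G s) : s.card ≤ indepNum G :=
  le_csSup (bddAbove_card_isIndepSet G) ⟨s, hs, rfl⟩

theorem exists_isIndepSet_card_eq_indepNum {V : Type} [Fintype V] (G : SimpleGraph V) :
    ∃ s : Finset V, IsIndepSet G s ∧ s.card = indepNum G :=
  Nat.sSup_mem (s := {n | ∃ s : Finset V, IsIndepSet G s ∧ s.card = n})
    ⟨0, ∅, by simp [IsIndepSet], rfl⟩ (bddAbove_card_isIndepSet G)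

theorem IsIndepSet.map {V W : Type} {G : SimpleGraph V} {H : SimpleGraph W} (f : G ↪g H)
    {s : Finset V} (hs : IsIndepSet G s) : IsIndepSet H (s.map f.toEmbedding) := by
  intro v hv w hw
  obtain ⟨v, hvs, rfl⟩ := Finset.mem_map.1 hv
  obtain ⟨w, hws, rfl⟩ := Finset.mem_map.1 hw
  exact fun h => hs v hvs w hws (f.map_adj_iff.1 h)

theorem not_adj_of_mem_supp_of_notMem_supp {V : Type} {G : SimpleGraph V}
    {c : G.ConnectedComponent} {v w : V} (hv : v ∈ c.supp) (hw : w ∉ c.supp) : ¬ G.Adj v w :=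
  fun h => hw (c.mem_supp_of_adj_mem_supp hv h)

theorem indepNum_induce_compl_supp_add_card_le {V : Type} [Fintype V] {G : SimpleGraph V}
    (c : G.ConnectedComponent) {t : Finset c.supp} (ht : IsIndepSet (G.induce c.supp) t) :
    indepNum (G.induce c.suppᶜ) + t.card ≤ indepNum G := by
  classical
  obtain ⟨u, hu, hcard⟩ := exists_isIndepSet_card_eq_indepNum (G.induce c.suppᶜ)
  set u' := u.map (Function.Embedding.subtype _) with hu'
  set t' := t.map (Function.Embedding.subtype _) with ht'
  have hu'c : ∀ v ∈ u', v ∉ c.supp := by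
    intro v hv
    obtain ⟨v, -, rfl⟩ := Finset.mem_map.1 hv
    exact v.2
  have ht'c : ∀ v ∈ t', v ∈ c.supp := by
    intro v hv
    obtain ⟨v, -, rfl⟩ := Finset.mem_map.1 hv
    exact v.2
  have hu'i : IsIndepSet G u' := hu.map (SimpleGraph.Embedding.induce _)
  have ht'i : IsIndepSet G t' := ht.map (SimpleGraph.Embedding.induce _)
  have hdisj : Disjoint u' t' :=
    Finset.disjoint_left.2 fun v hv hv' => hu'c v hv (ht'c v hv')
  have hunion : IsIndepSet G (u' ∪ t') := by
    intro v hv w hw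
    rcases Finset.mem_union.1 hv with hv | hv <;> rcases Finset.mem_union.1 hw with hw | hw
    · exact hu'i v hv w hw
    · exact fun h => not_adj_of_mem_supp_of_notMem_supp (ht'c w hw) (hu'c v hv) h.symm
    · exact not_adj_of_mem_supp_of_notMem_supp (ht'c v hv) (hu'c w hw)
    · exact ht'i v hv w hw
  have h := hunion.card_le_indepNum
  rwa [Finset.card_union_of_disjoint hdisj, hu', ht', Finset.card_map, Finset.card_map,
    hcard] at h

theorem card_compl_add_card {V : Type} [Finite V] (s : Set V) :
    Nat.card ↥sᶜ + Nat.card s = Nat.card V := by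
  rw [add_comm]
  exact Set.ncard_add_ncard_compl s

theorem numEdges_induce_compl_add_numEdges_induce_le {V : Type} [Finite V] (G : SimpleGraph V)
    (s : Set V) : numEdges (G.induce sᶜ) + numEdges (G.induce s) ≤ numEdges G := by
  unfold numEdges
  rw [← Nat.card_sum]
  refine Nat.card_le_card_of_injective
    (Sum.elim (SimpleGraph.Embedding.induce sᶜ).mapEdgeSet
      (SimpleGraph.Embedding.induce s).mapEdgeSet) ?_
  refine Function.Injective.sumElim (SimpleGraph.Embedding.induce sᶜ).mapEdgeSet.injective
    (SimpleGraph.Embedding.induce s).mapEdgeSet.injective ?_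
  rintro ⟨e, he⟩ ⟨f, hf⟩ h
  induction e with | _ x y
  induction f with | _ z w
  have h' : s((x : V), (y : V)) = s((z : V), (w : V)) := congrArg Subtype.val h
  rcases Sym2.eq_iff.1 h' with ⟨hx, -⟩ | ⟨hx, -⟩
  · exact x.2 (hx ▸ z.2)
  · exact x.2 (hx ▸ w.2)

theorem reachable_induce_compl_supp {V : Type} {G : SimpleGraph V} (c : G.ConnectedComponent)
    {v w : ↥c.suppᶜ} (h : G.Reachable v w) : (G.induce c.suppᶜ).Reachable v w := by
  obtain ⟨p⟩ := h
  classical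
  exact ⟨p.induce c.suppᶜ fun x hx hxc =>
    v.2 ((SimpleGraph.ConnectedComponent.sound ⟨p.takeUntil x hx⟩).trans hxc)⟩

theorem mem_supp_map_induce_compl_supp {V : Type} {G : SimpleGraph V}
    (c : G.ConnectedComponent) (d : (G.induce c.suppᶜ).ConnectedComponent) (v : ↥c.suppᶜ) :
    (v : V) ∈ (d.map (SimpleGraph.Embedding.induce c.suppᶜ).toHom).supp ↔ v ∈ d.supp := by
  induction d using SimpleGraph.ConnectedComponent.ind with | _ w
  simp only [SimpleGraph.ConnectedComponent.map_mk, SimpleGraph.ConnectedComponent.mem_supp_iff,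
    SimpleGraph.ConnectedComponent.eq]
  exact ⟨reachable_induce_compl_supp c,
    fun h => h.map (SimpleGraph.Embedding.induce c.suppᶜ).toHom⟩

theorem map_induce_compl_supp_ne {V : Type} {G : SimpleGraph V}
    (c : G.ConnectedComponent) (d : (G.induce c.suppᶜ).ConnectedComponent) :
    d.map (SimpleGraph.Embedding.induce c.suppᶜ).toHom ≠ c := by
  induction d using SimpleGraph.ConnectedComponent.ind with | _ w
  exact w.2

theorem map_induce_compl_supp_injective {V : Type} {G : SimpleGraph V}
    (c : G.ConnectedComponent) :
    Function.Injective fun d : (G.induce c.suppᶜ).ConnectedComponent =>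
      d.map (SimpleGraph.Embedding.induce c.suppᶜ).toHom := by
  intro d e h
  induction d using SimpleGraph.ConnectedComponent.ind with | _ v
  exact (mem_supp_map_induce_compl_supp c e v).1 h

theorem nonempty_iso_map_induce_compl_supp {V : Type} {G : SimpleGraph V}
    (c : G.ConnectedComponent) (d : (G.induce c.suppᶜ).ConnectedComponent) :
    Nonempty (G.induce (d.map (SimpleGraph.Embedding.induce c.suppᶜ).toHom).supp ≃g
      (G.induce c.suppᶜ).induce d.supp) := by
  let f : d.supp → (d.map (SimpleGraph.Embedding.induce c.suppᶜ).toHom).supp :=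
    fun x => ⟨x.1.1, (mem_supp_map_induce_compl_supp c d x.1).2 x.2⟩
  have hf : Function.Bijective f := by
    constructor
    · intro x y h
      have hxy : (f x : V) = f y := by rw [h]
      exact Subtype.ext (Subtype.ext hxy)
    · rintro ⟨x, hx⟩
      have hxc : x ∈ c.suppᶜ := fun hxc => map_induce_compl_supp_ne c d (hx.symm.trans hxc)
      exact ⟨⟨⟨x, hxc⟩, (mem_supp_map_induce_compl_supp c d ⟨x, hxc⟩).1 hx⟩, rfl⟩
  exact ⟨SimpleGraph.Iso.symm ⟨Equiv.ofBijective f hf, Iff.rfl⟩⟩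

theorem IsDifficult.map_induce_compl_supp {V : Type} {G : SimpleGraph V}
    {c : G.ConnectedComponent} {d : (G.induce c.suppᶜ).ConnectedComponent}
    (hd : IsDifficult _ d) :
    IsDifficult G (d.map (SimpleGraph.Embedding.induce c.suppᶜ).toHom) := by
  obtain ⟨e⟩ := nonempty_iso_map_induce_compl_supp c d
  exact hd.imp (fun ⟨f⟩ => ⟨e.trans f⟩) (fun ⟨f⟩ => ⟨e.trans f⟩)

theorem lambda_induce_compl_supp_add_one_le {V : Type} [Finite V] {G : SimpleGraph V}
    {c : G.ConnectedComponent} (hc : IsDifficult G c) :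
    lambda (G.induce c.suppᶜ) + 1 ≤ lambda G := by
  unfold lambda
  rw [← Finite.card_option]
  refine Nat.card_le_card_of_injective
    (fun o => o.elim ⟨c, hc⟩ fun d => ⟨_, d.2.map_induce_compl_supp⟩) ?_
  rintro (_ | d) (_ | e) h
  · rfl
  · exact (map_induce_compl_supp_ne c e.1 (congrArg Subtype.val h).symm).elim
  · exact (map_induce_compl_supp_ne c d.1 (congrArg Subtype.val h)).elim
  · exact congrArg some
      (Subtype.ext (map_induce_compl_supp_injective c (congrArg Subtype.val h)))

theorem numEdges_congr {V W : Type} {G : SimpleGraph V} {H : SimpleGraph W} (e : G ≃g H) :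
    numEdges G = numEdges H :=
  Nat.card_congr e.mapEdgeSet

theorem numEdges_top_fin_three : numEdges (⊤ : SimpleGraph (Fin 3)) = 3 := by
  rw [numEdges, Nat.card_eq_fintype_card, ← SimpleGraph.edgeFinset_card]
  decide

instance : DecidableRel chainGraph.Adj :=
  inferInstanceAs (DecidableRel (SimpleGraph.fromRel _).Adj)

theorem numEdges_chainGraph : numEdges chainGraph = 7 := by
  rw [numEdges, Nat.card_eq_fintype_card, ← SimpleGraph.edgeFinset_card]
  decide

theorem isIndepSet_top_fin_three : IsIndepSet (⊤ : SimpleGraph (Fin 3)) {0} := by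
  simp [IsIndepSet]

theorem isIndepSet_chainGraph : IsIndepSet chainGraph {0, 4} := by
  simp [IsIndepSet, chainGraph]

/-- A difficult component has `3k` vertices, `4k - 1` edges and an independent set of size `k`,
for some positive `k`. -/
theorem IsDifficult.exists_card {V : Type} {G : SimpleGraph V} {c : G.ConnectedComponent}
    (hc : IsDifficult G c) :
    ∃ k : ℕ, 0 < k ∧ Nat.card c.supp = 3 * k ∧ numEdges (G.induce c.supp) + 1 = 4 * k ∧
      ∃ t : Finset c.supp, IsIndepSet (G.induce c.supp) t ∧ t.card = k := by
  rcases hc with ⟨⟨e⟩⟩ | ⟨⟨e⟩⟩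
  · refine ⟨1, one_pos, ?_, ?_, _, isIndepSet_top_fin_three.map e.symm.toEmbedding, ?_⟩
    · simp [Nat.card_congr e.toEquiv]
    · rw [numEdges_congr e, numEdges_top_fin_three]
    · simp
  · refine ⟨2, two_pos, ?_, ?_, _, isIndepSet_chainGraph.map e.symm.toEmbedding, ?_⟩
    · simp [Nat.card_congr e.toEquiv]
    · rw [numEdges_congr e, numEdges_chainGraph]
    · rw [Finset.card_map]
      rfl

/-- Claim 2.4: a minimum counterexample has no difficult components. -/
theorem claim_lambda_zero
(a b : ℝ) (ha : 0 < a) (hb : 0 < b)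
    (h1 : 2 * a + b ≥ 1) (h2 : 3 * a + 4 * b ≥ 2) (h3 : 9 * a + 11 * b ≥ 6)
    (h4 : a + 5 * b ≥ 1) (h5 : 4 * a + 9 * b ≥ 3) (h6 : 10 * a + 16 * b ≥ 7)
    (h7 : 13 * a + 20 * b ≥ 8) (h8 : 5 * a + 14 * b ≥ 4)
    (h9 : a + (3 / 2) * b ≥ 2 / 3)
{V : Type} [Fintype V] (G : SimpleGraph V)
    (hG : ¬ HasTriangleAdjC4 G)
    (hcex : (indepNum G : ℝ) <
      (Nat.card V : ℝ) - (a * Nat.card V + b * numEdges G + b * lambda G))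
    (hmin : ∀ (W : Type) [Fintype W] (G' : SimpleGraph W),
      Nat.card W < Nat.card V → ¬ HasTriangleAdjC4 G' →
      (indepNum G' : ℝ) ≥
        (Nat.card W : ℝ) - (a * Nat.card W + b * numEdges G' + b * lambda G')) :
    lambda G = 0 := by
  classical
  by_contra hne
  have : Nonempty {c : G.ConnectedComponent // IsDifficult G c} :=
    (Nat.card_ne_zero.1 hne).1
  obtain ⟨c, hc⟩ := this
  obtain ⟨k, hk, hcard, hedge, t, ht, rfl⟩ := hc.exists_card
  have hV := card_compl_add_card c.supp
  have hE := numEdges_induce_compl_add_numEdges_induce_le G c.supp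
  have hL := lambda_induce_compl_supp_add_one_le hc
  have hI := indepNum_induce_compl_supp_add_card_le c ht
  have hM := hmin ↥c.suppᶜ (G.induce c.suppᶜ) (by omega) fun h => hG h.of_induce
  have hV' : (Nat.card V : ℝ) = Nat.card ↥c.suppᶜ + 3 * t.card := by
    rw [← hV, hcard]
    push_cast
    ring
  have hEL : (numEdges (G.induce c.suppᶜ) + lambda (G.induce c.suppᶜ) + 4 * t.card : ℝ) ≤
      numEdges G + lambda G := by
    exact_mod_cast (by omega)
  have hI' : (indepNum (G.induce c.suppᶜ) + t.card : ℝ) ≤ indepNum G := by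
    exact_mod_cast hI
  rw [hV'] at hcex
  nlinarith [mul_le_mul_of_nonneg_left hEL hb.le,
    mul_le_mul_of_nonneg_left h2 (Nat.cast_nonneg (α := ℝ) t.card)]

end Paper
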